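/- Let f : ℝ^n → ℝ be differentiable and convex with L_s-Lipschitz gradient, let x* be a minimizer of f with optimal value f*, and let (x_k) be gradient descent iterates x_{k+1} = x_k − α_k ∇f(x_k) with L_s·α_k ∈ (0,2) for all k. Suppose d > 0 is such that ‖x_j − x*‖ ≤ d for all j, and write F_j := f(x_j) − f*. Then for every k with F_{k+1} > 0, 1/F_{k+1} − 1/F_k ≥ (2 − L_s α_k)·α_k/(2 d²). -/

import Mathlib

open scoped RealInnerProductSpace

open AffineMap in
/-- The derivative of a function along a line, in terms of its gradient. -/
theorem HasGradientAt.hasDerivAt_comp_lineMap {E : Type*} [NormedAddCommGroup E]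
    [InnerProductSpace ℝ E] [CompleteSpace E] {f : E → ℝ} {g x y : E} {t : ℝ}
    (hf : HasGradientAt f g (lineMap x y t)) :
    HasDerivAt (fun s : ℝ => f (lineMap x y s)) ⟪g, y - x⟫ t := by
  exact (hf.hasFDerivAt.comp_hasDerivAt t hasDerivAt_lineMap).congr_deriv (by simp)

/-- The descent lemma: a function with `L`-Lipschitz gradient is bounded above by its
first-order expansion plus `L / 2 * ‖y - x‖ ^ 2`. -/
theorem descent_of_lipschitz_gradient {E : Type*} [NormedAddCommGroup E]
    [InnerProductSpace ℝ E] [CompleteSpace E] {f : E → ℝ} {f' : E → E}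
    (hdiff : ∀ z, HasGradientAt f (f' z) z) {L : ℝ}
    (hLip : ∀ u v, ‖f' v - f' u‖ ≤ L * ‖v - u‖) (x y : E) :
    f y ≤ f x + ⟪f' x, y - x⟫ + L / 2 * ‖y - x‖ ^ 2 := by
  have hf (t : ℝ) := (hdiff (AffineMap.lineMap x y t)).hasDerivAt_comp_lineMap
  have hB (t : ℝ) : HasDerivAt
      (fun s : ℝ => f x + s * ⟪f' x, y - x⟫ + L / 2 * ‖y - x‖ ^ 2 * s ^ 2)
      (⟪f' x, y - x⟫ + L * ‖y - x‖ ^ 2 * t) t := by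
    refine ((((hasDerivAt_id t).mul_const ⟪f' x, y - x⟫).const_add (f x)).add
      ((hasDerivAt_pow 2 t).const_mul (L / 2 * ‖y - x‖ ^ 2))).congr_deriv ?_
    push_cast
    ring
  have key := image_le_of_deriv_right_le_deriv_boundary (a := 0) (b := 1)
    (fun t _ => (hf t).continuousAt.continuousWithinAt)
    (fun t _ => (hf t).hasDerivWithinAt) (by simp)
    (fun t _ => (hB t).continuousAt.continuousWithinAt)
    (fun t _ => (hB t).hasDerivWithinAt) ?_ (Set.right_mem_Icc.2 zero_le_one)
  · simpa using key
  · intro t ht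
    have h := hLip x (AffineMap.lineMap x y t)
    rw [AffineMap.lineMap_apply, vsub_eq_sub, vadd_eq_add, add_sub_cancel_right, norm_smul,
      Real.norm_of_nonneg ht.1] at h
    have h' := (real_inner_le_norm _ (y - x)).trans
      (mul_le_mul_of_nonneg_right h (norm_nonneg (y - x)))
    rw [inner_sub_left] at h'
    simp only [AffineMap.lineMap_apply, vsub_eq_sub, vadd_eq_add] at h' ⊢
    linarith

/-- First-order condition for convexity: a convex function lies above its tangents. -/
theorem ConvexOn.add_inner_gradient_le {E : Type*} [NormedAddCommGroup E]
    [InnerProductSpace ℝ E] [CompleteSpace E] {f : E → ℝ} (hf : ConvexOn ℝ Set.univ f)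
    {g x : E} (hg : HasGradientAt f g x) (y : E) :
    f x + ⟪g, y - x⟫ ≤ f y := by
  have hc : ConvexOn ℝ Set.univ (fun s : ℝ => f (AffineMap.lineMap x y s)) :=
    hf.comp_affineMap (AffineMap.lineMap x y)
  have hd : HasDerivAt (fun s : ℝ => f (AffineMap.lineMap x y s)) ⟪g, y - x⟫ 0 :=
    HasGradientAt.hasDerivAt_comp_lineMap (by simpa using hg)
  have h := hc.le_slope_of_hasDerivAt (Set.mem_univ 0) (Set.mem_univ 1) zero_lt_one hd
  simp only [slope_def_field, AffineMap.lineMap_apply_zero, AffineMap.lineMap_apply_one,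
    sub_zero, div_one] at h
  linarith

/-- Inverse optimality gap increase for gradient descent on an `Ls`-smooth convex
function with `Ls α_k ∈ (0,2)`: if the iterates stay within distance `d` of a
minimizer, then `1/F_{k+1} - 1/F_k ≥ (2 - Ls α_k) α_k / (2 d²)` whenever `F_{k+1} > 0`. -/
theorem gd_inverse_gap_increase
    {n : ℕ} (f : EuclideanSpace ℝ (Fin n) → ℝ)
    (f' : EuclideanSpace ℝ (Fin n) → EuclideanSpace ℝ (Fin n))
    (hdiff : ∀ z, HasGradientAt f (f' z) z)
    (hconv : ConvexOn ℝ Set.univ f)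
    (Ls : ℝ) (hLs : 0 < Ls)
    (hLip : ∀ u v, ‖f' v - f' u‖ ≤ Ls * ‖v - u‖)
    (xs : EuclideanSpace ℝ (Fin n)) (hmin : ∀ z, f xs ≤ f z)
    (α : ℕ → ℝ) (hα : ∀ k, 0 < Ls * α k ∧ Ls * α k < 2)
    (x : ℕ → EuclideanSpace ℝ (Fin n))
    (hstep : ∀ k, x (k + 1) = x k - α k • f' (x k))
    (d : ℝ) (hd : 0 < d) (hbound : ∀ j, ‖x j - xs‖ ≤ d) :
    ∀ k : ℕ, 0 < f (x (k + 1)) - f xs →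
      (2 - Ls * α k) * α k / (2 * d ^ 2) ≤
        1 / (f (x (k + 1)) - f xs) - 1 / (f (x k) - f xs) := by
  intro k hpos
  obtain ⟨hα0, hα2⟩ := hα k
  have hαpos : 0 < α k := pos_of_mul_pos_right hα0 hLs.le
  set c := (2 - Ls * α k) * α k / 2 with hc
  have hc0 : 0 < c := by have := mul_pos (sub_pos.2 hα2) hαpos; positivity
  have hdesc : f (x (k + 1)) ≤ f (x k) - c * ‖f' (x k)‖ ^ 2 := by
    have h := descent_of_lipschitz_gradient hdiff hLip (x k) (x (k + 1))
    rw [show x (k + 1) - x k = -(α k • f' (x k)) by rw [hstep]; abel, inner_neg_right,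
      inner_smul_right, real_inner_self_eq_norm_sq, norm_neg, norm_smul,
      Real.norm_of_nonneg hαpos.le] at h
    rw [hc]
    linarith
  have hgap : f (x k) - f xs ≤ ‖f' (x k)‖ * d := by
    have h := hconv.add_inner_gradient_le (hdiff (x k)) xs
    have h' := real_inner_le_norm (f' (x k)) (x k - xs)
    have h'' := mul_le_mul_of_nonneg_left (hbound k) (norm_nonneg (f' (x k)))
    rw [← neg_sub (x k) xs, inner_neg_right] at h
    linarith
  have hmono : f (x (k + 1)) - f xs ≤ f (x k) - f xs := by
    have : 0 ≤ c * ‖f' (x k)‖ ^ 2 := by positivity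
    linarith
  have hdrop : c * ‖f' (x k)‖ ^ 2 ≤ (f (x k) - f xs) - (f (x (k + 1)) - f xs) := by linarith
  generalize f (x (k + 1)) - f xs = b at *
  generalize f (x k) - f xs = a at *
  have ha : 0 < a := hpos.trans_le hmono
  have hab : b * a ≤ ‖f' (x k)‖ ^ 2 * d ^ 2 := calc
    b * a ≤ a * a := by gcongr
    _ ≤ (‖f' (x k)‖ * d) * (‖f' (x k)‖ * d) := by gcongr
    _ = ‖f' (x k)‖ ^ 2 * d ^ 2 := by ring
  rw [← div_div, ← hc, div_sub_div _ _ hpos.ne' ha.ne', div_le_div_iff₀ (by positivity)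
    (by positivity)]
  calc c * (b * a) ≤ c * (‖f' (x k)‖ ^ 2 * d ^ 2) := by gcongr
    _ = c * ‖f' (x k)‖ ^ 2 * d ^ 2 := by ring
    _ ≤ (1 * a - b * 1) * d ^ 2 := by gcongr; linarith
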